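/- arXiv:1202.0869 — 4 statements merged into one kernel-verified Lean document; each statement's English description precedes it below -/
import Mathlib

section
/- Let q be a real number with q > 1, let r ≥ 1 and g ≥ 1 be natural numbers, let a : ℕ → ℝ and b ∈ ℝ. Assume: for every natural number m with m ≤ 2(g-1), q^(r(g-1)) · a(m) − q^(r·m) · a(2(g-1)−m) = (q^(r·m) − q^(r(g-1))) · b; and for every m ≥ 2g−1, q^(r(g-1)) · a(m) = (q^(r·m) − q^(r(g-1))) · b. Then for every real number t with 0 < |t| < 1/q, the series Σ_{m=0}^∞ a(m)·t^(r·m) converges, and its sum equals Σ_{m=0}^{g-2} a(m)·(t^(r·m) + q^(r(g-1-m))·t^(r(2(g-1)-m))) + a(g−1)·t^(r(g-1)) + b·(q^r − 1)·t^(r·g) / ((1 − q^r·t^r)·(1 − t^r)). -/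
open Finset

/-- The sum of `(Q ^ k - 1) T ^ k` as a difference of two geometric series. -/
lemma hasSum_pow_sub_one_mul_pow {Q T : ℝ} (hT : |T| < 1) (hQT : |Q * T| < 1) :
    HasSum (fun k : ℕ => (Q ^ k - 1) * T ^ k) ((Q - 1) * T / ((1 - Q * T) * (1 - T))) := by
  have h1 : 1 - T ≠ 0 := by linarith [le_abs_self T]
  have h2 : 1 - Q * T ≠ 0 := by linarith [le_abs_self (Q * T)]
  have h := (hasSum_geometric_of_abs_lt_one hQT).sub (hasSum_geometric_of_abs_lt_one hT)
  have hsum : (1 - Q * T)⁻¹ - (1 - T)⁻¹ = (Q - 1) * T / ((1 - Q * T) * (1 - T)) := by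
    rw [inv_sub_inv h2 h1]
    ring
  rw [hsum] at h
  simpa only [mul_pow, sub_mul, one_mul] using h

/-- A power series whose coefficients satisfy a duality about `n` up to a multiple of
`Q ^ k - 1`, and equal that multiple beyond `2 * n`, is a rational function. -/
lemma hasSum_of_duality {Q T : ℝ} (hT : |T| < 1) (hQT : |Q * T| < 1) (n : ℕ)
    (a : ℕ → ℝ) (b : ℝ)
    (hdual : ∀ k ≤ n, a (k + n) = Q ^ k * a (n - k) + (Q ^ k - 1) * b)
    (hvanish : ∀ k, n < k → a (k + n) = (Q ^ k - 1) * b) :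
    HasSum (fun m : ℕ => a m * T ^ m)
      (∑ m ∈ Finset.range n, a m * (T ^ m + Q ^ (n - m) * T ^ (2 * n - m))
        + a n * T ^ n + b * (Q - 1) * T ^ (n + 1) / ((1 - Q * T) * (1 - T))) := by
  have hfin : HasSum (fun k : ℕ => if k ≤ n then Q ^ k * a (n - k) * T ^ (k + n) else 0)
      (∑ m ∈ Finset.range n, a m * (Q ^ (n - m) * T ^ (2 * n - m)) + a n * T ^ n) := by
    have hsupp : ∀ k ∉ Finset.range (n + 1),
        (if k ≤ n then Q ^ k * a (n - k) * T ^ (k + n) else 0) = 0 := fun k hk =>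
      if_neg (by simpa [Nat.lt_succ_iff] using hk)
    convert hasSum_sum_of_ne_finset_zero (L := .unconditional ℕ) hsupp using 1
    symm
    rw [← Finset.sum_range_reflect, Finset.sum_range_succ]
    congr 1
    · refine Finset.sum_congr rfl fun m hm => ?_
      have hm : m < n := Finset.mem_range.mp hm
      rw [if_pos (by omega), show n + 1 - 1 - m = n - m by omega,
        show n - (n - m) = m by omega, show n - m + n = 2 * n - m by omega]
      ring
    · simp
  have htail := hfin.add ((hasSum_pow_sub_one_mul_pow hT hQT).mul_left (b * T ^ n))
  have hcoeff : (fun k : ℕ => (if k ≤ n then Q ^ k * a (n - k) * T ^ (k + n) else 0)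
      + b * T ^ n * ((Q ^ k - 1) * T ^ k)) = fun k => a (k + n) * T ^ (k + n) := by
    funext k
    split_ifs with hk
    · rw [hdual k hk]
      ring
    · rw [hvanish k (not_le.mp hk)]
      ring
  rw [hcoeff] at htail
  have h := (hasSum_nat_add_iff (f := fun m => a m * T ^ m) n).mp htail
  convert h using 1
  · rfl
  · simp only [mul_add, Finset.sum_add_distrib]
    ring

/-- Analytic rationality of Weng's pure non-abelian rank-`r` zeta function:
under the Serre-duality and Riemann–Roch-vanishing relations on the abstract
coefficients `a` (playing the role of `α_{X,r}(rm)`) and `b` (playing the role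
of `β_{X,r}(0)`), for `0 < |t| < 1/q` the series `Σ_{m≥0} a(m) t^(rm)` converges
with sum
`Σ_{m=0}^{g-2} a(m)(t^(rm) + q^(r(g-1-m)) t^(r(2(g-1)-m))) + a(g-1) t^(r(g-1))
  + b (q^r − 1) t^(rg) / ((1 − q^r t^r)(1 − t^r))`. -/
theorem weng_zeta_rationality_real
    (q : ℝ) (hq : 1 < q) (r g : ℕ) (hr : 1 ≤ r) (hg : 1 ≤ g)
    (a : ℕ → ℝ) (b : ℝ)
    (hduality : ∀ m : ℕ, m ≤ 2 * (g - 1) →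
      q ^ (r * (g - 1)) * a m - q ^ (r * m) * a (2 * (g - 1) - m)
        = (q ^ (r * m) - q ^ (r * (g - 1))) * b)
    (hvanishing : ∀ m : ℕ, 2 * g - 1 ≤ m →
      q ^ (r * (g - 1)) * a m = (q ^ (r * m) - q ^ (r * (g - 1))) * b) :
    ∀ t : ℝ, 0 < |t| → |t| < 1 / q →
      HasSum (fun m : ℕ => a m * t ^ (r * m))
        (∑ m ∈ Finset.range (g - 1),
            a m * (t ^ (r * m) + q ^ (r * (g - 1 - m)) * t ^ (r * (2 * (g - 1) - m)))
          + a (g - 1) * t ^ (r * (g - 1))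
          + b * (q ^ r - 1) * t ^ (r * g) / ((1 - q ^ r * t ^ r) * (1 - t ^ r))) := by
  intro t _ ht
  have hq0 : 0 < q := by linarith
  have hr0 : r ≠ 0 := by omega
  have hqt : |q * t| < 1 := by
    rw [abs_mul, abs_of_pos hq0, mul_comm]
    exact (lt_div_iff₀ hq0).mp ht
  have ht1 : |t| < 1 := ht.trans ((div_lt_one hq0).mpr hq)
  obtain ⟨n, rfl⟩ : ∃ n, g = n + 1 := ⟨g - 1, by omega⟩
  simp only [Nat.add_sub_cancel, pow_mul] at hduality hvanishing ⊢
  have hQ : (q ^ r) ^ n ≠ 0 := by positivity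
  refine hasSum_of_duality ?_ ?_ n a b (fun k hk => ?_) (fun k hk => ?_)
  · rw [abs_pow]
    exact pow_lt_one₀ (abs_nonneg t) ht1 hr0
  · rw [← mul_pow, abs_pow]
    exact pow_lt_one₀ (abs_nonneg _) hqt hr0
  · have h := hduality (k + n) (by omega)
    rw [show 2 * n - (k + n) = n - k by omega, pow_add] at h
    apply mul_left_cancel₀ hQ
    linear_combination h
  · have h := hvanishing (k + n) (by omega)
    rw [pow_add] at h
    apply mul_left_cancel₀ hQ
    linear_combination h
end

section
/- Let q be a nonzero real number, let r ≥ 1 and g ≥ 1 be natural numbers, let a : ℕ → ℝ and b ∈ ℝ. Define, for real t with t ≠ 0, t^r ≠ 1 and q^r·t^r ≠ 1, the function Ẑ(t) := t^(−r(g−1)) · ( Σ_{m=0}^{g-2} a(m)·(t^(r·m) + q^(r(g-1-m))·t^(r(2(g-1)-m))) + a(g−1)·t^(r(g-1)) + b·(q^r − 1)·t^(r·g) / ((1 − q^r·t^r)·(1 − t^r)) ). Then for every real t with t ≠ 0, t^r ≠ 1 and q^r·t^r ≠ 1, one has Ẑ(1/(q·t)) = Ẑ(t). -/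
open Finset

/-- The closed rational form of Weng's complete pure non-abelian rank-`r` zeta
function: `Ẑ(t) = t^(−r(g−1)) · (Σ_{m=0}^{g-2} a(m)(t^(rm) + q^(r(g-1-m)) t^(r(2(g-1)-m)))
  + a(g-1) t^(r(g-1)) + b (q^r − 1) t^(rg) / ((1 − q^r t^r)(1 − t^r)))`. -/
noncomputable def wengZhat (q : ℝ) (r g : ℕ) (a : ℕ → ℝ) (b : ℝ) (t : ℝ) : ℝ :=
  t ^ (-(r * (g - 1) : ℤ)) *
    (∑ m ∈ Finset.range (g - 1),
        a m * (t ^ (r * m) + q ^ (r * (g - 1 - m)) * t ^ (r * (2 * (g - 1) - m)))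
      + a (g - 1) * t ^ (r * (g - 1))
      + b * (q ^ r - 1) * t ^ (r * g) / ((1 - q ^ r * t ^ r) * (1 - t ^ r)))

/-- Absorbing the prefactor `t ^ (-r(g-1))` makes every summand of `wengZhat` a function of
`t ^ r` and `q ^ r` alone. -/
theorem wengZhat_succ (q : ℝ) (r n : ℕ) (a : ℕ → ℝ) (b : ℝ) {t : ℝ} (ht : t ≠ 0) :
    wengZhat q r (n + 1) a b t =
      ∑ m ∈ Finset.range n, a m * (((t ^ r) ^ (n - m))⁻¹ + (q ^ r * t ^ r) ^ (n - m))
        + a n + b * (q ^ r - 1) * (t ^ r / ((1 - q ^ r * t ^ r) * (1 - t ^ r))) := by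
  have hT : t ^ r ≠ 0 := pow_ne_zero r ht
  have hpre : t ^ (-(r * ((n + 1 : ℕ) - 1) : ℤ)) = ((t ^ r) ^ n)⁻¹ := by
    rw [zpow_neg, ← pow_mul, ← zpow_natCast]
    push_cast
    rw [add_sub_cancel_right]
  unfold wengZhat
  rw [hpre]
  simp only [add_tsub_cancel_right, pow_mul]
  rw [mul_add, mul_add, Finset.mul_sum]
  congr 1
  · congr 1
    · refine Finset.sum_congr rfl fun m hm => ?_
      obtain ⟨k, rfl⟩ := Nat.exists_eq_add_of_le (Finset.mem_range.1 hm).le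
      rw [show 2 * (m + k) - m = (m + k) + k by omega, Nat.add_sub_cancel_left]
      generalize t ^ r = T at hT ⊢
      rw [mul_pow, pow_add T (m + k) k, pow_add T m k]
      field_simp
    · field_simp
  · rw [pow_succ]
    field_simp

/-- Functional equation `Ẑ(1/(qt)) = Ẑ(t)` for the closed rational form of
Weng's complete pure non-abelian rank-`r` zeta function. -/
theorem weng_zeta_functional_equation
    (q : ℝ) (hq : q ≠ 0) (r g : ℕ) (hr : 1 ≤ r) (hg : 1 ≤ g)
    (a : ℕ → ℝ) (b : ℝ) :
    ∀ t : ℝ, t ≠ 0 → t ^ r ≠ 1 → q ^ r * t ^ r ≠ 1 →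
      wengZhat q r g a b (1 / (q * t)) = wengZhat q r g a b t := by
  intro t ht h₁ h₂
  obtain ⟨n, rfl⟩ := Nat.exists_eq_add_of_le' hg
  have hQ : q ^ r ≠ 0 := pow_ne_zero r hq
  have hT : t ^ r ≠ 0 := pow_ne_zero r ht
  rw [wengZhat_succ q r n a b (one_div_ne_zero (mul_ne_zero hq ht)), wengZhat_succ q r n a b ht,
    one_div, inv_pow, mul_pow]
  generalize q ^ r = Q at *
  generalize t ^ r = T at *
  have hQT : Q * (Q * T)⁻¹ = T⁻¹ := by field_simp
  rw [hQT]
  congr 2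
  · refine Finset.sum_congr rfl fun m _ => ?_
    rw [inv_pow, inv_inv, inv_pow, add_comm]
  · have h₃ : 1 - T ≠ 0 := sub_ne_zero.2 h₁.symm
    have h₄ : 1 - Q * T ≠ 0 := sub_ne_zero.2 h₂.symm
    have h₅ : (1 - T⁻¹) * (1 - (Q * T)⁻¹) = (Q * T)⁻¹ * T⁻¹ * ((1 - Q * T) * (1 - T)) := by
      field_simp
      ring
    rw [h₅]
    field_simp
end

section
/- Let q be a nonzero real number, let r ≥ 1 and g ≥ 1 be natural numbers, and let b ∈ ℝ. Define, for real t with t ≠ 0, t^r ≠ 1 and q^r·t^r ≠ 1, the tail term h(t) := b·(q^r − 1)·t^(r·g) / ((1 − q^r·t^r)·(1 − t^r)). Then for every real t with t ≠ 0, t^r ≠ 1 and q^r·t^r ≠ 1, one has (q·t²)^(r(g−1)) · h(1/(q·t)) = h(t). -/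
/-- The tail term of the rational closed form of Weng's pure non-abelian
rank-`r` zeta function: `h(t) = b (q^r − 1) t^(rg) / ((1 − q^r t^r)(1 − t^r))`. -/
noncomputable def wengTail (q : ℝ) (r g : ℕ) (b : ℝ) (t : ℝ) : ℝ :=
  b * (q ^ r - 1) * t ^ (r * g) / ((1 - q ^ r * t ^ r) * (1 - t ^ r))

/-- Symmetry of the tail term of the rational closed form of Weng's pure
non-abelian rank-`r` zeta function: `(q t²)^(r(g−1)) · h(1/(qt)) = h(t)`. -/
theorem weng_tail_symmetry
    (q : ℝ) (hq : q ≠ 0) (r g : ℕ) (hr : 1 ≤ r) (hg : 1 ≤ g) (b : ℝ) :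
    ∀ t : ℝ, t ≠ 0 → t ^ r ≠ 1 → q ^ r * t ^ r ≠ 1 →
      (q * t ^ 2) ^ (r * (g - 1)) * wengTail q r g b (1 / (q * t))
        = wengTail q r g b t := by
  intro t ht hT hQT
  obtain ⟨m, rfl⟩ := Nat.exists_eq_add_of_le' hg
  have hQ0 : q ^ r ≠ 0 := pow_ne_zero r hq
  have hT0 : t ^ r ≠ 0 := pow_ne_zero r ht
  simp only [wengTail, Nat.add_sub_cancel, pow_mul, div_pow, one_pow, mul_pow,
    pow_right_comm t 2 r]
  generalize q ^ r = Q at *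
  generalize t ^ r = T at *
  have h1 : 1 - T ≠ 0 := sub_ne_zero.mpr hT.symm
  have h2 : 1 - Q * T ≠ 0 := sub_ne_zero.mpr hQT.symm
  have e1 : 1 - Q * (1 / (Q * T)) = -(1 - T) / T := by
    field_simp
    ring
  have e2 : 1 - 1 / (Q * T) = -(1 - Q * T) / (Q * T) := by
    field_simp
    ring
  rw [e1, e2]
  field_simp
  ring
end

section
/- Let q be a real number with q > 1, let r ≥ 1 and g ≥ 1 be natural numbers, let a : ℕ → ℝ and b ∈ ℝ. Assume: for every natural number m with m ≤ 2(g-1), q^(r(g-1)) · a(m) − q^(r·m) · a(2(g-1)−m) = (q^(r·m) − q^(r(g-1))) · b; and for every m ≥ 2g−1, q^(r(g-1)) · a(m) = (q^(r·m) − q^(r(g-1))) · b. Define, for real t with t ≠ 0, t^r ≠ 1 and q^r·t^r ≠ 1, Ẑ(t) := t^(−r(g−1)) · ( Σ_{m=0}^{g-2} a(m)·(t^(r·m) + q^(r(g-1-m))·t^(r(2(g-1)-m))) + a(g−1)·t^(r(g-1)) + b·(q^r − 1)·t^(r·g) / ((1 − q^r·t^r)·(1 − t^r)) ). Then: (1)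 for every real t with 0 < |t| < 1/q, the series Σ_{m=0}^∞ a(m)·t^(r·m) converges and Ẑ(t) = t^(−r(g−1)) · Σ_{m=0}^∞ a(m)·t^(r·m); and (2) for every real t with t ≠ 0, t^r ≠ 1 and q^r·t^r ≠ 1, one has Ẑ(1/(q·t)) = Ẑ(t). -/
open Finset

/-- The bracketed factor of `wengZhat` in the variables `Q = q ^ r` and `T = t ^ r`. -/
noncomputable def wengBracket (Q : ℝ) (G : ℕ) (a : ℕ → ℝ) (b T : ℝ) : ℝ :=
  ∑ m ∈ Finset.range G, a m * (T ^ m + Q ^ (G - m) * T ^ (2 * G - m))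
    + a G * T ^ G + b * (Q - 1) * T ^ (G + 1) / ((1 - Q * T) * (1 - T))

lemma zpow_neg_mul_succ_sub_one (t : ℝ) (r G : ℕ) :
    t ^ (-((r : ℤ) * (((G + 1 : ℕ) : ℤ) - 1))) = ((t ^ r) ^ G)⁻¹ := by
  rw [zpow_neg, ← pow_mul, ← zpow_natCast]
  push_cast
  ring_nf

lemma wengZhat_succ_eq (q : ℝ) (r G : ℕ) (a : ℕ → ℝ) (b t : ℝ) :
    wengZhat q r (G + 1) a b t = ((t ^ r) ^ G)⁻¹ * wengBracket (q ^ r) G a b (t ^ r) := by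
  simp only [wengZhat, wengBracket, zpow_neg_mul_succ_sub_one, Nat.add_sub_cancel, pow_mul]

lemma hasSum_wengBracket {Q T b : ℝ} {G : ℕ} {a : ℕ → ℝ} (hT : |T| < 1) (hQT : |Q * T| < 1)
    (hlow : ∀ n < G, a (n + (G + 1)) = Q ^ (n + 1) * a (G - 1 - n) + (Q ^ (n + 1) - 1) * b)
    (hhigh : ∀ n, G ≤ n → a (n + (G + 1)) = (Q ^ (n + 1) - 1) * b) :
    HasSum (fun m ↦ a m * T ^ m) (wengBracket Q G a b T) := by
  have hT1 : 1 - T ≠ 0 := (sub_pos.mpr (abs_lt.mp hT).2).ne'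
  have hQT1 : 1 - Q * T ≠ 0 := (sub_pos.mpr (abs_lt.mp hQT).2).ne'
  let e : ℕ → ℝ := fun n ↦ if n < G then Q ^ (n + 1) * a (G - 1 - n) * T ^ (n + (G + 1)) else 0
  have he : HasSum e (∑ n ∈ Finset.range G, e n) :=
    hasSum_sum_of_ne_finset_zero fun n hn ↦ if_neg (by simpa using hn)
  have he' : ∑ n ∈ Finset.range G, e n
      = ∑ m ∈ Finset.range G, a m * (Q ^ (G - m) * T ^ (2 * G - m)) := by
    rw [← Finset.sum_range_reflect]
    refine Finset.sum_congr rfl fun m hm ↦ ?_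
    have hm : m < G := Finset.mem_range.mp hm
    have h1 : G - 1 - m < G := by omega
    have h2 : G - 1 - m + 1 = G - m := by omega
    have h3 : G - 1 - (G - 1 - m) = m := by omega
    have h4 : G - 1 - m + (G + 1) = 2 * G - m := by omega
    simp only [e, if_pos h1, h2, h3, h4]
    ring
  rw [he'] at he
  have hgeom := (((hasSum_geometric_of_abs_lt_one hQT).mul_left (Q * T)).sub
    ((hasSum_geometric_of_abs_lt_one hT).mul_left T)).mul_left (b * T ^ G)
  rw [← hasSum_nat_add_iff' (G + 1)]
  convert he.add hgeom using 1
  · rfl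
  · funext n
    by_cases hn : n < G
    · simp only [e, if_pos hn, hlow n hn]
      ring
    · simp only [e, if_neg hn, hhigh n (not_lt.mp hn)]
      ring
  · simp only [wengBracket, mul_add, Finset.sum_add_distrib, Finset.sum_range_succ]
    field_simp
    ring

lemma wengBracket_inv {Q T : ℝ} (hQ : Q ≠ 0) (hT : T ≠ 0) (hT1 : T ≠ 1) (hQT : Q * T ≠ 1)
    (G : ℕ) (a : ℕ → ℝ) (b : ℝ) :
    (((Q * T)⁻¹) ^ G)⁻¹ * wengBracket Q G a b (Q * T)⁻¹ = (T ^ G)⁻¹ * wengBracket Q G a b T := by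
  have hT1' : 1 - T ≠ 0 := sub_ne_zero.mpr hT1.symm
  have hQT' : 1 - Q * T ≠ 0 := sub_ne_zero.mpr hQT.symm
  have hT2 : T - 1 ≠ 0 := sub_ne_zero.mpr hT1
  have hQT2 : Q * T - 1 ≠ 0 := sub_ne_zero.mpr hQT
  simp only [wengBracket, mul_add, Finset.mul_sum]
  congr 1
  · congr 1
    · refine Finset.sum_congr rfl fun m hm ↦ ?_
      obtain ⟨k, rfl⟩ := Nat.exists_eq_add_of_lt (Finset.mem_range.mp hm)
      have h1 : m + k + 1 - m = k + 1 := by omega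
      have h2 : 2 * (m + k + 1) - m = m + k + 1 + (k + 1) := by omega
      rw [h1, h2]
      simp only [inv_pow, mul_pow, pow_add]
      field_simp
      ring
    · field_simp
  · have h1 : 1 - Q * (Q * T)⁻¹ = (T - 1) / T := by field_simp
    have h2 : 1 - (Q * T)⁻¹ = (Q * T - 1) / (Q * T) := by field_simp
    rw [h1, h2, pow_succ, pow_succ]
    field_simp
    ring

/-- Zeta Facts (i) and (ii) for Weng's complete pure non-abelian rank-`r` zeta
function: under the Serre-duality and Riemann–Roch-vanishing relations on the
abstract coefficients `a` and `b`, (1) for `0 < |t| < 1/q` the defining series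
`Σ_{m≥0} a(m) t^(rm)` converges and `Ẑ(t) = t^(−r(g−1)) · Σ_{m≥0} a(m) t^(rm)`,
and (2) `Ẑ(1/(qt)) = Ẑ(t)` wherever both sides are defined. -/
theorem weng_zeta_rationality_and_functional_equation
    (q : ℝ) (hq : 1 < q) (r g : ℕ) (hr : 1 ≤ r) (hg : 1 ≤ g)
    (a : ℕ → ℝ) (b : ℝ)
    (hduality : ∀ m : ℕ, m ≤ 2 * (g - 1) →
      q ^ (r * (g - 1)) * a m - q ^ (r * m) * a (2 * (g - 1) - m)
        = (q ^ (r * m) - q ^ (r * (g - 1))) * b)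
    (hvanishing : ∀ m : ℕ, 2 * g - 1 ≤ m →
      q ^ (r * (g - 1)) * a m = (q ^ (r * m) - q ^ (r * (g - 1))) * b) :
    (∀ t : ℝ, 0 < |t| → |t| < 1 / q →
        Summable (fun m : ℕ => a m * t ^ (r * m)) ∧
        wengZhat q r g a b t
          = t ^ (-(r * (g - 1) : ℤ)) * ∑' m : ℕ, a m * t ^ (r * m)) ∧
    (∀ t : ℝ, t ≠ 0 → t ^ r ≠ 1 → q ^ r * t ^ r ≠ 1 →
        wengZhat q r g a b (1 / (q * t)) = wengZhat q r g a b t) := by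
  obtain ⟨G, rfl⟩ := Nat.exists_eq_add_of_le' hg
  have hq0 : 0 < q := by linarith
  have hQ : q ^ r ≠ 0 := (pow_pos hq0 r).ne'
  have hr0 : r ≠ 0 := by omega
  simp only [Nat.add_sub_cancel, pow_mul] at hduality hvanishing
  refine ⟨fun t ht htq ↦ ?_, fun t ht hT1 hQT ↦ ?_⟩
  · have hqt : |q * t| < 1 := by
      rw [abs_mul, abs_of_pos hq0, mul_comm]
      exact (lt_div_iff₀ hq0).mp htq
    have ht1 : |t| < 1 := htq.trans ((div_lt_one hq0).mpr hq)
    have hsum : HasSum (fun m ↦ a m * (t ^ r) ^ m) (wengBracket (q ^ r) G a b (t ^ r)) := by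
      refine hasSum_wengBracket ?_ ?_ (fun n hn ↦ ?_) (fun n hn ↦ ?_)
      · rw [abs_pow]
        exact pow_lt_one₀ (abs_nonneg t) ht1 hr0
      · rw [← mul_pow, abs_pow]
        exact pow_lt_one₀ (abs_nonneg _) hqt hr0
      · have h := hduality (n + (G + 1)) (by omega)
        rw [show 2 * G - (n + (G + 1)) = G - 1 - n by omega,
          show n + (G + 1) = G + (n + 1) by omega, pow_add] at h
        rw [show n + (G + 1) = G + (n + 1) by omega]
        apply mul_left_cancel₀ (pow_ne_zero G hQ)
        linear_combination h
      · have h := hvanishing (n + (G + 1)) (by omega)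
        rw [show n + (G + 1) = G + (n + 1) by omega, pow_add] at h
        rw [show n + (G + 1) = G + (n + 1) by omega]
        apply mul_left_cancel₀ (pow_ne_zero G hQ)
        linear_combination h
    simp only [pow_mul]
    refine ⟨hsum.summable, ?_⟩
    rw [hsum.tsum_eq, wengZhat_succ_eq, zpow_neg_mul_succ_sub_one]
  · rw [wengZhat_succ_eq, wengZhat_succ_eq, one_div, inv_pow, mul_pow]
    exact wengBracket_inv hQ (pow_ne_zero r ht) hT1 hQT G a b
end
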